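/- Let n, p ≥ 1, B⁺ = {b ∈ ℝ^p : b₁ ≥ … ≥ b_p ≥ 1}, and λ ∈ ℝ^p. Suppose ∑_{i=1}^{j} (λ_i − n + 1) < 0 for every j ∈ {1,…,p}. Then for every a ∈ [1,∞)^n the integral L(a,λ) = ∫_{B⁺} ∏_{i=1}^{p} ( ∏_{k=1}^{n} (a_k² + b_i²)^{-1/2} ) b_i^{λ_i} db₁…db_p is finite. Moreover, for any family of numbers η_{k,i} ∈ [0,1] (1 ≤ k ≤ n, 1 ≤ i ≤ p) satisfying ∑_{i=1}^{j} (λ_i − n + 1 + ∑_{k=1}^{n} η_{k,i}) < 0 for every j ∈ {1,…,p}, there is a constant C > 0 (independent of a) such that L(a,λ) ≤ C ∏_{k=1}^{n} a_k^{-μ_k} for all a ∈ [1,∞)^n, where μ_k = ∑_{i=1}^{p} η_{k,i}. -/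

import Mathlib

open MeasureTheory Set Finset

/-- The region `B⁺ = {b ∈ ℝ^p : b₁ ≥ b₂ ≥ … ≥ b_p ≥ 1}`. -/
def Bplus (p : ℕ) : Set (Fin p → ℝ) :=
  {b | (∀ i, 1 ≤ b i) ∧ ∀ i j : Fin p, i ≤ j → b j ≤ b i}

/-- Abel summation: if every partial sum of `d` is nonpositive and `x` is antitone and
nonnegative, then `∑ i, d i * x i ≤ 0`. -/
lemma sum_mul_nonpos_of_antitone {p : ℕ} (d x : Fin p → ℝ) (hx : Antitone x)
    (hx0 : ∀ i, 0 ≤ x i) (hd : ∀ j, ∑ i ∈ Finset.Iic j, d i ≤ 0) :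
    ∑ i, d i * x i ≤ 0 := by
  induction p with
  | zero => simp
  | succ p ih =>
    have h := ih (fun i => d i.castSucc) (fun i => x i.castSucc - x (Fin.last p))
      (fun i j hij => sub_le_sub_right (hx (Fin.castSucc_le_castSucc_iff.2 hij)) _)
      (fun i => sub_nonneg.2 (hx (Fin.le_last _)))
      (fun j => by
        have := hd j.castSucc
        rwa [← Fin.map_castSuccEmb_Iic, Finset.sum_map] at this)
    have hlast := hd (Fin.last p)
    rw [← Fin.top_eq_last, Finset.Iic_top, Fin.sum_univ_castSucc] at hlast
    rw [Fin.sum_univ_castSucc]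
    simp only [mul_sub, Finset.sum_sub_distrib, ← Finset.sum_mul] at h
    nlinarith [mul_nonneg (hx0 (Fin.last p)) (neg_nonneg.2 hlast)]

/-- Strict negativity of the finitely many partial sums leaves a uniform linear margin. -/
lemma exists_pos_sum_Iic_add_nonpos {p : ℕ} (d : Fin p → ℝ)
    (hd : ∀ j, ∑ i ∈ Finset.Iic j, d i < 0) :
    ∃ ε > 0, ∀ j, ∑ i ∈ Finset.Iic j, (d i + ε) ≤ 0 := by
  have h : ∀ᶠ ε : ℝ in nhdsWithin 0 (Set.Ioi 0), ∀ j, ∑ i ∈ Finset.Iic j, (d i + ε) < 0 := by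
    rw [Filter.eventually_all]
    intro j
    have hc : Continuous fun ε : ℝ => ∑ i ∈ Finset.Iic j, (d i + ε) := by fun_prop
    exact (hc.continuousAt.eventually_lt continuousAt_const (by simpa using hd j)).filter_mono
      nhdsWithin_le_nhds
  obtain ⟨ε, hε, hpos⟩ := (h.and self_mem_nhdsWithin).exists
  exact ⟨ε, hpos, fun j => (hε j).le⟩

lemma measurableSet_Bplus (p : ℕ) : MeasurableSet (Bplus p) := by
  unfold Bplus
  measurability

lemma prod_rpow_le_of_mem_Bplus {p : ℕ} (c : Fin p → ℝ) (ε : ℝ)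
    (hε : ∀ j, ∑ i ∈ Finset.Iic j, (c i + 1 + ε) ≤ 0) {b : Fin p → ℝ} (hb : b ∈ Bplus p) :
    ∏ i, b i ^ c i ≤ ∏ i, b i ^ (-1 - ε) := by
  have hpos : ∀ i, 0 < b i := fun i => one_pos.trans_le (hb.1 i)
  have h := sum_mul_nonpos_of_antitone (fun i => c i + 1 + ε) (fun i => Real.log (b i))
    (fun i j hij => Real.log_le_log (hpos j) (hb.2 i j hij))
    (fun i => Real.log_nonneg (hb.1 i)) hε
  simp only [Real.rpow_def_of_pos (hpos _), ← Real.exp_sum]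
  rw [Real.exp_le_exp, ← sub_nonpos, ← Finset.sum_sub_distrib]
  convert h using 2
  ring

lemma integrableOn_prod_rpow_Bplus {p : ℕ} (c : Fin p → ℝ)
    (hc : ∀ j, ∑ i ∈ Finset.Iic j, (c i + 1) < 0) :
    IntegrableOn (fun b : Fin p → ℝ => ∏ i, b i ^ c i) (Bplus p) := by
  obtain ⟨ε, hε, h⟩ := exists_pos_sum_Iic_add_nonpos _ hc
  have h1 : Integrable ((Set.Ici (1 : ℝ)).indicator fun t => t ^ (-1 - ε)) := by
    rw [integrable_indicator_iff measurableSet_Ici, integrableOn_Ici_iff_integrableOn_Ioi]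
    exact integrableOn_Ioi_rpow_of_lt (by linarith) one_pos
  have h2 : IntegrableOn (fun b : Fin p → ℝ =>
      ∏ i, (Set.Ici (1 : ℝ)).indicator (fun t => t ^ (-1 - ε)) (b i)) (Bplus p) :=
    (Integrable.fintype_prod (μ := fun _ : Fin p => volume) fun _ => h1).integrableOn
  refine h2.mono' (Measurable.aestronglyMeasurable (by fun_prop)) ?_
  filter_upwards [ae_restrict_mem (measurableSet_Bplus p)] with b hb
  have hpos : ∀ i, 0 < b i := fun i => one_pos.trans_le (hb.1 i)
  rw [Real.norm_of_nonneg (Finset.prod_nonneg fun i _ => Real.rpow_nonneg (hpos i).le _)]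
  refine (prod_rpow_le_of_mem_Bplus c ε h hb).trans_eq (Finset.prod_congr rfl fun i _ => ?_)
  exact (Set.indicator_of_mem (Set.mem_Ici.2 (hb.1 i)) fun t : ℝ => t ^ (-1 - ε)).symm

lemma rpow_neg_half_sq_add_sq_le {a b η : ℝ} (ha : 0 < a) (hb : 0 < b)
    (hη : η ∈ Set.Icc (0 : ℝ) 1) :
    (a ^ 2 + b ^ 2) ^ (-(1 : ℝ) / 2) ≤ a ^ (-η) * b ^ (η - 1) := by
  have hs : 0 < a ^ 2 + b ^ 2 := by positivity
  have hinv : a ^ (-η) * b ^ (η - 1) = (a ^ η * b ^ (1 - η))⁻¹ := by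
    rw [mul_inv, ← Real.rpow_neg ha.le, ← Real.rpow_neg hb.le, neg_sub]
  rw [hinv, neg_div, Real.rpow_neg hs.le, ← Real.sqrt_eq_rpow]
  refine inv_anti₀ (by positivity) ?_
  have hsa : a ≤ √(a ^ 2 + b ^ 2) := Real.le_sqrt_of_sq_le (by nlinarith)
  have hsb : b ≤ √(a ^ 2 + b ^ 2) := Real.le_sqrt_of_sq_le (by nlinarith)
  calc a ^ η * b ^ (1 - η) ≤ √(a ^ 2 + b ^ 2) ^ η * √(a ^ 2 + b ^ 2) ^ (1 - η) :=
        mul_le_mul (Real.rpow_le_rpow ha.le hsa hη.1)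
          (Real.rpow_le_rpow hb.le hsb (sub_nonneg.2 hη.2)) (by positivity) (by positivity)
    _ = √(a ^ 2 + b ^ 2) := by
        rw [← Real.rpow_add (Real.sqrt_pos.2 hs), add_sub_cancel, Real.rpow_one]

lemma prod_kernel_le {n p : ℕ} (lam : Fin p → ℝ) (η : Fin n → Fin p → ℝ)
    (hη : ∀ k i, η k i ∈ Set.Icc (0 : ℝ) 1) {a : Fin n → ℝ} (ha : ∀ k, 0 < a k)
    {b : Fin p → ℝ} (hb : ∀ i, 0 < b i) :
    ∏ i, (∏ k, (a k ^ 2 + b i ^ 2) ^ (-(1 : ℝ) / 2)) * b i ^ lam i ≤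
      (∏ k, a k ^ (-(∑ i, η k i))) * ∏ i, b i ^ (lam i - n + ∑ k, η k i) := by
  have hR : (∏ k, a k ^ (-(∑ i, η k i))) * ∏ i, b i ^ (lam i - n + ∑ k, η k i) =
      ∏ i, (∏ k, a k ^ (-η k i) * b i ^ (η k i - 1)) * b i ^ lam i := by
    simp only [← Finset.sum_neg_distrib, Real.rpow_sum_of_pos (ha _)]
    rw [Finset.prod_comm, ← Finset.prod_mul_distrib]
    refine Finset.prod_congr rfl fun i _ => ?_
    rw [Finset.prod_mul_distrib, ← Real.rpow_sum_of_pos (hb i), mul_assoc,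
      ← Real.rpow_add (hb i)]
    congr 2
    simp only [Finset.sum_sub_distrib, Finset.sum_const, Finset.card_univ, Fintype.card_fin,
      nsmul_eq_mul, mul_one]
    ring
  rw [hR]
  have hs : ∀ i k, 0 ≤ (a k ^ 2 + b i ^ 2) ^ (-(1 : ℝ) / 2) := fun i k => by positivity
  have hbl : ∀ i, 0 ≤ b i ^ lam i := fun i => Real.rpow_nonneg (hb i).le _
  exact Finset.prod_le_prod
    (fun i _ => mul_nonneg (Finset.prod_nonneg fun k _ => hs i k) (hbl i))
    fun i _ => mul_le_mul_of_nonneg_right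
      (Finset.prod_le_prod (fun k _ => hs i k)
        fun k _ => rpow_neg_half_sq_add_sq_le (ha k) (hb i) (hη k i)) (hbl i)

lemma integrableOn_kernel {n p : ℕ} (lam : Fin p → ℝ)
    (hlam : ∀ j : Fin p, ∑ i ∈ Finset.Iic j, (lam i - n + 1) < 0)
    {a : Fin n → ℝ} (ha : ∀ k, 0 < a k) :
    IntegrableOn
      (fun b : Fin p → ℝ => ∏ i, (∏ k, (a k ^ 2 + b i ^ 2) ^ (-(1 : ℝ) / 2)) * b i ^ lam i)
      (Bplus p) := by
  refine (integrableOn_prod_rpow_Bplus (fun i => lam i - n) hlam).mono' (by fun_prop) ?_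
  filter_upwards [ae_restrict_mem (measurableSet_Bplus p)] with b hb
  have hpos : ∀ i, 0 < b i := fun i => one_pos.trans_le (hb.1 i)
  rw [Real.norm_of_nonneg]
  · simpa using prod_kernel_le lam (fun (_ : Fin n) _ => 0) (by simp) ha hpos
  · exact Finset.prod_nonneg fun i _ => mul_nonneg
      (Finset.prod_nonneg fun k _ => by positivity) (Real.rpow_nonneg (hpos i).le _)

/-- Let `n, p ≥ 1` and `λ ∈ ℝ^p` with `∑_{i≤j} (λᵢ − n + 1) < 0` for all `j`. Then
for every `a ∈ [1,∞)^n` the integral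
`L(a,λ) = ∫_{B⁺} ∏ᵢ (∏ₖ (aₖ² + bᵢ²)^{-1/2}) bᵢ^{λᵢ} db` is finite. Moreover, for a
family `η_{k,i} ∈ [0,1]` with `∑_{i≤j} (λᵢ − n + 1 + ∑ₖ η_{k,i}) < 0` for all `j`,
there is `C > 0` independent of `a` with `L(a,λ) ≤ C ∏ₖ aₖ^{-μₖ}` for all
`a ∈ [1,∞)^n`, where `μₖ = ∑ᵢ η_{k,i}`. -/
theorem stmt_9 (n p : ℕ) (hn : 1 ≤ n) (hp : 1 ≤ p) (lam : Fin p → ℝ)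
    (hlam : ∀ j : Fin p, ∑ i ∈ Finset.Iic j, (lam i - n + 1) < 0) :
    (∀ a : Fin n → ℝ, (∀ k, 1 ≤ a k) →
      IntegrableOn
        (fun b : Fin p → ℝ =>
          ∏ i, (∏ k, (a k ^ 2 + b i ^ 2) ^ (-(1 : ℝ) / 2)) * b i ^ lam i)
        (Bplus p)) ∧
    (∀ η : Fin n → Fin p → ℝ, (∀ k i, η k i ∈ Set.Icc (0 : ℝ) 1) →
      (∀ j : Fin p, ∑ i ∈ Finset.Iic j, (lam i - n + 1 + ∑ k, η k i) < 0) →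
      ∃ C > (0 : ℝ), ∀ a : Fin n → ℝ, (∀ k, 1 ≤ a k) →
        (∫ b in Bplus p,
            ∏ i, (∏ k, (a k ^ 2 + b i ^ 2) ^ (-(1 : ℝ) / 2)) * b i ^ lam i) ≤
          C * ∏ k, a k ^ (-(∑ i, η k i))) := by
  refine ⟨fun a ha => integrableOn_kernel lam hlam fun k => one_pos.trans_le (ha k),
    fun η hη hsum => ?_⟩
  have hint := integrableOn_prod_rpow_Bplus (fun i => lam i - n + ∑ k, η k i) fun j => by
    simpa only [add_right_comm] using hsum j
  have hnonneg : 0 ≤ ∫ b in Bplus p, ∏ i, b i ^ (lam i - n + ∑ k, η k i) :=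
    setIntegral_nonneg (measurableSet_Bplus p) fun b hb =>
      Finset.prod_nonneg fun i _ => Real.rpow_nonneg (zero_le_one.trans (hb.1 i)) _
  refine ⟨(∫ b in Bplus p, ∏ i, b i ^ (lam i - n + ∑ k, η k i)) + 1, by linarith,
    fun a ha => ?_⟩
  have hpos : ∀ k, 0 < a k := fun k => one_pos.trans_le (ha k)
  have hA : 0 ≤ ∏ k, a k ^ (-(∑ i, η k i)) :=
    Finset.prod_nonneg fun k _ => Real.rpow_nonneg (hpos k).le _
  have hle := setIntegral_mono_on (integrableOn_kernel lam hlam hpos)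
    (hint.const_mul (∏ k, a k ^ (-(∑ i, η k i)))) (measurableSet_Bplus p)
    fun b hb => prod_kernel_le lam η hη hpos fun i => one_pos.trans_le (hb.1 i)
  rw [integral_const_mul] at hle
  linarith
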